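/- Let k ≥ 1, let ν be a probability measure on M, let f ∈ H¹(ν) with ∫ f² dν = 1 and ∫ Γ(f) dν ≤ Λ for a real number Λ, and let p₁, …, p_{k−1} ∈ H¹(ν) and positive reals λ₁, …, λ_{k−1}, λ be such that: (a) ∫ p_i p_j dν = 0 for all i ≠ j; (b) for every i and every g ∈ H¹(ν), ∫ Γ(p_i, g) dν = λ_i ∫ p_i g dν; (c) ∫ (f − Σ_{j=1}^{k−1} p_j) p_i dν = 0 for every i; (d) for every g ∈ H¹(ν) with ∫ g p_i dν = 0 for all i, λ ∫ g² dν ≤ ∫ Γ(g) dν. Set p^⊥ = f − Σ_{i=1}^{k−1} p_i. Then for every g ∈ H¹(ν) with ∫ g p_i dν = 0 for all i, | ∫ ( λ p^⊥ g − Γ(p^⊥, g) ) dν | ≤ [ Λ − λ + Σ_{i=1}^{k−1} (λ − λ_i) ∫ p_i² dν ]^{1/2} · ( ∫ Γ(g) dν )^{1/2}, the bracket being nonnegative by the eigenvalue-comparison lemma. -/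

import Mathlib

open MeasureTheory Real

/-- Membership in `H¹(ν)`: `C¹`, centered, with integrable carré du champ
`Γ(f)(x) = a(x) f'(x)²`. -/
def MemH1 (a : ℝ → ℝ) (ν : MeasureTheory.Measure ℝ) (f : ℝ → ℝ) : Prop :=
  ContDiff ℝ 1 f ∧ (∫ x, f x ∂ν) = 0 ∧
    MeasureTheory.Integrable (fun x => a x * (deriv f x) ^ 2) ν

section BilinearForms

open LinearMap (BilinForm)

variable {V ι : Type*} [AddCommGroup V] [Module ℝ V] [Fintype ι]
  {B G : BilinForm ℝ V} {p : ι → V} {l : ι → ℝ} {lam : ℝ}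

/-- An orthogonal system of weak eigenvectors, together with the improved Poincaré inequality on
its orthogonal complement, gives a Poincaré inequality on the whole space. -/
theorem exists_poincare_of_eigenvectors (hB : ∀ u v, B u v = B v u) (hG : ∀ u v, G u v = G v u)
    (hGnonneg : ∀ u, 0 ≤ G u u) (hl : ∀ i, 0 < l i) (hlam : 0 < lam)
    (horth : ∀ i j, i ≠ j → B (p i) (p j) = 0)
    (heig : ∀ i u, G (p i) u = l i * B (p i) u)
    (hpoinc : ∀ u, (∀ i, B u (p i) = 0) → lam * B u u ≤ G u u) :
    ∃ C, 0 ≤ C ∧ ∀ u, B u u ≤ C * G u u := by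
  refine ⟨lam⁻¹ + ∑ i, (l i)⁻¹,
    add_nonneg (inv_nonneg.2 hlam.le) (Finset.sum_nonneg fun i _ => (inv_pos.2 (hl i)).le),
    fun u => ?_⟩
  set b : ι → ℝ := fun i => B (p i) (p i) with hb
  set β : ι → ℝ := fun i => B (p i) u with hβ
  set c : ι → ℝ := fun i => β i / b i with hc
  have hbnonneg (i) : 0 ≤ b i := by
    have h := hGnonneg (p i)
    rw [heig] at h
    exact nonneg_of_mul_nonneg_right h (hl i)
  have hcs (i) : l i * β i ^ 2 ≤ b i * G u u := by
    have h := G.apply_mul_apply_le_of_forall_zero_le hGnonneg (p i) u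
    rw [hG u, heig, heig] at h
    have h' : l i * (l i * β i ^ 2) ≤ l i * (b i * G u u) := by
      simp only [hb, hβ]; linarith
    exact le_of_mul_le_mul_left h' (hl i)
  have hcb (i) : c i * b i = β i := by
    by_cases h : b i = 0
    · have h1 := hcs i
      rw [h, zero_mul] at h1
      have h2 : β i ^ 2 ≤ 0 := nonpos_of_mul_nonpos_right h1 (hl i)
      have h3 : β i = 0 := by nlinarith [sq_nonneg (β i)]
      simp [h, h3]
    · exact div_mul_cancel₀ _ h
  have hcβ (i) : 0 ≤ c i * β i := by
    rw [← hcb i]; nlinarith [mul_nonneg (sq_nonneg (c i)) (hbnonneg i)]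
  have hcβle (i) : c i * β i ≤ (l i)⁻¹ * G u u := by
    by_cases h : b i = 0
    · simpa [hc, h] using mul_nonneg (inv_pos.2 (hl i)).le (hGnonneg u)
    · have hpos : 0 < b i := lt_of_le_of_ne (hbnonneg i) (Ne.symm h)
      rw [inv_mul_eq_div, le_div_iff₀ (hl i)]
      have : c i * β i * l i = l i * β i ^ 2 / b i := by simp only [hc]; ring
      rw [this, div_le_iff₀ hpos]
      linarith [hcs i]
  obtain ⟨w, hw⟩ : ∃ w, w = u - ∑ i, c i • p i := ⟨_, rfl⟩
  have hwp (i) : B (p i) w = 0 := by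
    have : ∑ j, c j * B (p i) (p j) = c i * b i :=
      Finset.sum_eq_single_of_mem i (Finset.mem_univ i) fun j _ hj => by
        rw [horth i j (Ne.symm hj), mul_zero]
    simp only [hw, map_sub, map_sum, map_smul, smul_eq_mul, this, hcb, hβ, sub_self]
  have hexpand (A : BilinForm ℝ V) (hA : ∀ u v, A u v = A v u) (hAw : ∀ i, A (p i) w = 0) :
      A w w = A u u - ∑ i, c i * A (p i) u := by
    have h1 (v : V) : A v w = A v u - ∑ i, c i * A v (p i) := by
      simp only [hw, map_sub, map_sum, map_smul, smul_eq_mul]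
    rw [h1 w, hA w u, h1 u]
    simp only [hA w, hAw, hA u (p _), mul_zero, Finset.sum_const_zero, sub_zero]
  have hBw := hexpand B hB hwp
  have hGw := hexpand G hG fun i => by rw [heig, hwp, mul_zero]
  have hmain := hpoinc w fun i => by rw [hB, hwp i]
  have hGsum : 0 ≤ ∑ i, c i * G (p i) u := Finset.sum_nonneg fun i _ => by
    rw [heig, mul_left_comm]
    exact mul_nonneg (hl i).le (hcβ i)
  have hBsum : ∑ i, c i * B (p i) u ≤ (∑ i, (l i)⁻¹) * G u u := by
    rw [Finset.sum_mul]
    exact Finset.sum_le_sum fun i _ => hcβle i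
  have hBw_le : B w w ≤ lam⁻¹ * G u u := by
    rw [inv_mul_eq_div, le_div_iff₀ hlam]
    linarith
  rw [add_mul]
  linarith

/-- The approximate integration by parts formula for abstract symmetric forms. -/
theorem abs_sub_le_of_eigenvectors (hB : ∀ u v, B u v = B v u) (hG : ∀ u v, G u v = G v u)
    (hBnonneg : ∀ u, 0 ≤ B u u) (hlam : 0 ≤ lam)
    (horth : ∀ i j, i ≠ j → B (p i) (p j) = 0)
    (heig : ∀ i u, G (p i) u = l i * B (p i) u)
    (hpoinc : ∀ u, (∀ i, B u (p i) = 0) → lam * B u u ≤ G u u)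
    {f q g : V} (hq : q = f - ∑ i, p i) (hqp : ∀ i, B q (p i) = 0) (hgp : ∀ i, B g (p i) = 0) :
    |lam * B q g - G q g| ≤
      √(G f f - lam * B f f + ∑ i, (lam - l i) * B (p i) (p i)) * √(G g g) := by
  have hdisc : discrim (G g g - lam * B g g) (2 * (G q g - lam * B q g))
      (G q q - lam * B q q) ≤ 0 := by
    refine discrim_le_zero fun t => ?_
    have h := hpoinc (q + t • g) fun i => by simp [hqp, hgp]
    simp only [map_add, map_smul, LinearMap.add_apply, LinearMap.smul_apply, smul_eq_mul,
      hB g q, hG g q] at h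
    linarith
  have hqq : G q q - lam * B q q =
      G f f - lam * B f f + ∑ i, (lam - l i) * B (p i) (p i) := by
    have hf : f = q + ∑ i, p i := by rw [hq, sub_add_cancel]
    have hpp (i) : ∑ j, B (p i) (p j) = B (p i) (p i) :=
      Finset.sum_eq_single_of_mem i (Finset.mem_univ i) fun j _ hj => horth i j (Ne.symm hj)
    have hpq (i) : B (p i) q = 0 := by rw [hB, hqp]
    have hBf : B f f = B q q + ∑ i, B (p i) (p i) := by
      rw [hf]
      simp only [map_add, map_sum, LinearMap.add_apply, LinearMap.sum_apply, hqp, hpq,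
        Finset.sum_const_zero, add_zero, zero_add]
      rw [Finset.sum_comm]
      simp only [hpp]
    have hGf : G f f = G q q + ∑ i, l i * B (p i) (p i) := by
      rw [hf]
      simp only [map_add, map_sum, LinearMap.add_apply, LinearMap.sum_apply, hG q (p _), heig, hpq,
        mul_zero, Finset.sum_const_zero, add_zero, zero_add]
      rw [Finset.sum_comm]
      simp only [← Finset.mul_sum, hpp]
    rw [hBf, hGf, mul_add, Finset.mul_sum]
    simp only [sub_mul, Finset.sum_sub_distrib]
    ring
  have hqnonneg : 0 ≤ G q q - lam * B q q := sub_nonneg.2 (hpoinc q hqp)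
  rw [← hqq, ← Real.sqrt_mul hqnonneg]
  refine Real.abs_le_sqrt ?_
  rw [discrim] at hdisc
  have := mul_nonneg hqnonneg (mul_nonneg hlam (hBnonneg g))
  nlinarith

end BilinearForms

section Truncation

/-- A smooth bounded `1`-Lipschitz truncation of the identity. -/
noncomputable def smoothTrunc (n : ℕ) (x : ℝ) : ℝ := x / (1 + x ^ 2 / (n + 1))

theorem one_add_sq_div_pos (n : ℕ) (x : ℝ) : 0 < 1 + x ^ 2 / ((n : ℝ) + 1) := by positivity

theorem contDiff_smoothTrunc (n : ℕ) : ContDiff ℝ 1 (smoothTrunc n) :=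
  contDiff_id.div (by fun_prop) fun x => (one_add_sq_div_pos n x).ne'

theorem abs_deriv_smoothTrunc_le (n : ℕ) (x : ℝ) : |deriv (smoothTrunc n) x| ≤ 1 := by
  have hpos := one_add_sq_div_pos n x
  have h : HasDerivAt (smoothTrunc n)
      ((1 * (1 + x ^ 2 / ((n : ℝ) + 1)) - x * (2 * x / ((n : ℝ) + 1)))
        / (1 + x ^ 2 / ((n : ℝ) + 1)) ^ 2) x := by
    refine (hasDerivAt_id x).div ?_ hpos.ne'
    simpa using ((hasDerivAt_pow 2 x).div_const ((n : ℝ) + 1)).const_add 1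
  have ht : 0 ≤ x ^ 2 / ((n : ℝ) + 1) := by positivity
  rw [h.deriv, abs_div, abs_of_pos (pow_pos hpos 2), div_le_one (pow_pos hpos 2),
    show x * (2 * x / ((n : ℝ) + 1)) = 2 * (x ^ 2 / ((n : ℝ) + 1)) by ring, abs_le]
  constructor <;> nlinarith

theorem smoothTrunc_sq_le (n : ℕ) (x : ℝ) : smoothTrunc n x ^ 2 ≤ x ^ 2 := by
  rw [smoothTrunc, div_pow]
  refine div_le_self (sq_nonneg x) (one_le_pow₀ ?_)
  have : 0 ≤ x ^ 2 / ((n : ℝ) + 1) := by positivity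
  linarith

theorem abs_smoothTrunc_le (n : ℕ) (x : ℝ) : |smoothTrunc n x| ≤ n + 1 := by
  have hpos := one_add_sq_div_pos n x
  have hn : (0 : ℝ) < n + 1 := by positivity
  rw [smoothTrunc, abs_div, abs_of_pos hpos, div_le_iff₀ hpos, mul_add, mul_div_cancel₀ _ hn.ne',
    ← sq_abs x]
  have : (0 : ℝ) ≤ n := Nat.cast_nonneg n
  nlinarith [sq_nonneg (|x| - 1)]

theorem tendsto_smoothTrunc (x : ℝ) :
    Filter.Tendsto (fun n => smoothTrunc n x) Filter.atTop (nhds x) := by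
  have h := (tendsto_one_div_add_atTop_nhds_zero_nat (𝕜 := ℝ)).const_mul (x ^ 2)
  have h2 := (tendsto_const_nhds (x := x)).div (h.const_add 1) (by simp)
  simpa [smoothTrunc, div_eq_mul_inv, Pi.mul_def, Pi.inv_def] using h2

variable {ν : Measure ℝ} [IsProbabilityMeasure ν] {g : ℝ → ℝ}

/-- The truncation of `g`, recentred so that it has zero mean. -/
noncomputable def centeredTrunc (ν : Measure ℝ) (g : ℝ → ℝ) (n : ℕ) (x : ℝ) : ℝ :=
  smoothTrunc n (g x) - ∫ y, smoothTrunc n (g y) ∂ν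

theorem memLp_smoothTrunc (hg : AEStronglyMeasurable g ν) (n : ℕ) (q : ENNReal) :
    MemLp (fun x => smoothTrunc n (g x)) q ν :=
  .of_bound ((contDiff_smoothTrunc n).continuous.comp_aestronglyMeasurable hg) (n + 1)
    (.of_forall fun x => abs_smoothTrunc_le n (g x))

theorem memLp_centeredTrunc (hg : AEStronglyMeasurable g ν) (n : ℕ) (q : ENNReal) :
    MemLp (centeredTrunc ν g n) q ν :=
  (memLp_smoothTrunc hg n q).sub (memLp_const _)

/-- A function whose centred truncations are bounded in `L²` is itself in `L²`. -/
theorem memLp_two_of_centeredTrunc_le (hg : AEStronglyMeasurable g ν) {C : ℝ}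
    (hC : ∀ n, ∫ x, centeredTrunc ν g n x ^ 2 ∂ν ≤ C) : MemLp g 2 ν := by
  have hw : Integrable (fun x => (1 + g x ^ 2)⁻¹) ν := by
    refine .of_bound (C := 1) ?_ (.of_forall fun x => ?_)
    · exact (hg.aemeasurable.pow_const 2 |>.const_add 1).inv.aestronglyMeasurable
    · rw [norm_inv, Real.norm_of_nonneg (by positivity)]
      exact inv_le_one_of_one_le₀ (by nlinarith [sq_nonneg (g x)])
  have hwpos : 0 < ∫ x, (1 + g x ^ 2)⁻¹ ∂ν := by
    refine (integral_pos_iff_support_of_nonneg (fun x => by positivity) hw).2 ?_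
    have : Function.support (fun x => (1 + g x ^ 2)⁻¹) = Set.univ :=
      Set.eq_univ_of_forall fun x => (by positivity : (1 + g x ^ 2)⁻¹ ≠ 0)
    simp [this]
  set w := ∫ x, (1 + g x ^ 2)⁻¹ ∂ν
  have hu (n) : Integrable (fun x => 2 * centeredTrunc ν g n x ^ 2) ν :=
    (memLp_centeredTrunc hg n 2).integrable_sq.const_mul 2
  have hmean (n) : (∫ y, smoothTrunc n (g y) ∂ν) ^ 2 ≤ (2 * C + 2) / w := by
    rw [le_div_iff₀ hwpos, ← integral_const_mul]
    calc _ ≤ ∫ x, (2 * centeredTrunc ν g n x ^ 2 + 2) ∂ν := by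
          refine integral_mono (hw.const_mul _) ((hu n).add (integrable_const _)) fun x => ?_
          have hpos : 0 < 1 + g x ^ 2 := by positivity
          have h1 := smoothTrunc_sq_le n (g x)
          simp only [centeredTrunc]
          rw [← div_eq_mul_inv, div_le_iff₀ hpos]
          set s := smoothTrunc n (g x)
          set c := ∫ y, smoothTrunc n (g y) ∂ν
          nlinarith [sq_nonneg (2 * s - c), mul_nonneg (sq_nonneg (s - c)) (sq_nonneg (g x))]
      _ ≤ 2 * C + 2 := by
          rw [integral_add (hu n) (integrable_const _), integral_const_mul]
          simpa using hC n
  have hbound (n) : ∫ x, smoothTrunc n (g x) ^ 2 ∂ν ≤ 2 * C + 2 * ((2 * C + 2) / w) := by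
    calc _ ≤ ∫ x, (2 * centeredTrunc ν g n x ^ 2 + 2 * ((2 * C + 2) / w)) ∂ν := by
          refine integral_mono (memLp_smoothTrunc hg n 2).integrable_sq
            ((hu n).add (integrable_const _)) fun x => ?_
          have h1 := hmean n
          simp only [centeredTrunc]
          set s := smoothTrunc n (g x)
          set c := ∫ y, smoothTrunc n (g y) ∂ν
          nlinarith [sq_nonneg (s - 2 * c)]
      _ ≤ _ := by
          rw [integral_add (hu n) (integrable_const _), integral_const_mul]
          simpa using hC n
  refine (memLp_two_iff_integrable_sq hg).2 (integrable_of_tendsto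
    (G := fun n x => smoothTrunc n (g x) ^ 2)
    (.of_forall fun x => (tendsto_smoothTrunc (g x)).pow 2)
    (fun n => (memLp_smoothTrunc hg n 2).integrable_sq.aestronglyMeasurable) ?_)
  refine ((Filter.liminf_le_of_frequently_le' (.of_forall fun n => ?_)).trans_lt
    (ENNReal.ofReal_lt_top (r := 2 * C + 2 * ((2 * C + 2) / w)))).ne
  rw [← ofReal_integral_norm_eq_lintegral_enorm (memLp_smoothTrunc hg n 2).integrable_sq]
  refine ENNReal.ofReal_le_ofReal ?_
  simpa using hbound n

end Truncation

section EnergySpace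

variable {a : ℝ → ℝ} {ν : Measure ℝ}

theorem integrable_mul_mul_of_sq {u v : ℝ → ℝ} (hu : AEMeasurable u ν) (hv : AEMeasurable v ν)
    (hau : Integrable (fun x => a x * u x ^ 2) ν) (hav : Integrable (fun x => a x * v x ^ 2) ν) :
    Integrable (fun x => a x * u x * v x) ν := by
  refine (hau.norm.add hav.norm).mono' ?_ (.of_forall fun x => ?_)
  · have h : (fun x => a x * u x * v x) = fun x => a x * u x ^ 2 * (u x)⁻¹ * v x := by
      funext x
      by_cases hx : u x = 0
      · simp [hx]
      · field_simp
    rw [h]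
    exact ((hau.aemeasurable.mul hu.inv).mul hv).aestronglyMeasurable
  · simp only [Pi.add_apply, Real.norm_eq_abs, abs_mul, abs_pow]
    nlinarith [mul_nonneg (abs_nonneg (a x)) (sq_nonneg (|u x| - |v x|)),
      mul_nonneg (abs_nonneg (a x)) (add_nonneg (sq_nonneg |u x|) (sq_nonneg |v x|))]

theorem MemH1.differentiable {f : ℝ → ℝ} (hf : MemH1 a ν f) : Differentiable ℝ f :=
  hf.1.differentiable (by simp)

theorem MemH1.measurable_deriv {f : ℝ → ℝ} (_hf : MemH1 a ν f) : AEMeasurable (deriv f) ν :=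
  (_root_.measurable_deriv f).aemeasurable

theorem MemH1.aestronglyMeasurable {f : ℝ → ℝ} (hf : MemH1 a ν f) : AEStronglyMeasurable f ν :=
  hf.1.continuous.aestronglyMeasurable

theorem MemH1.integrable_energy {f g : ℝ → ℝ} (hf : MemH1 a ν f) (hg : MemH1 a ν g) :
    Integrable (fun x => a x * deriv f x * deriv g x) ν :=
  integrable_mul_mul_of_sq hf.measurable_deriv hg.measurable_deriv hf.2.2 hg.2.2

theorem deriv_centeredTrunc {g : ℝ → ℝ} (hg : Differentiable ℝ g) (n : ℕ) (x : ℝ) :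
    deriv (centeredTrunc ν g n) x = deriv (smoothTrunc n) (g x) * deriv g x :=
  ((((contDiff_smoothTrunc n).differentiable (by simp) (g x)).hasDerivAt.comp x
    (hg x).hasDerivAt).sub_const _).deriv

theorem sq_deriv_centeredTrunc_le {g : ℝ → ℝ} (hg : Differentiable ℝ g) (n : ℕ) (x : ℝ) :
    deriv (centeredTrunc ν g n) x ^ 2 ≤ deriv g x ^ 2 := by
  rw [deriv_centeredTrunc hg, mul_pow]
  exact mul_le_of_le_one_left (sq_nonneg _) ((sq_le_one_iff_abs_le_one _).2
    (abs_deriv_smoothTrunc_le n (g x)))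

variable [IsProbabilityMeasure ν]

theorem MemH1.centeredTrunc {g : ℝ → ℝ} (hg : MemH1 a ν g) (n : ℕ) :
    MemH1 a ν (centeredTrunc ν g n) := by
  refine ⟨((contDiff_smoothTrunc n).comp hg.1).sub contDiff_const, ?_, ?_⟩
  · have h := (memLp_smoothTrunc hg.aestronglyMeasurable n 1).integrable le_rfl
    simp only [_root_.centeredTrunc]
    rw [integral_sub h (integrable_const _)]
    simp
  · have h : (fun x => a x * deriv (_root_.centeredTrunc ν g n) x ^ 2) =
        fun x => a x * deriv g x ^ 2 * deriv (smoothTrunc n) (g x) ^ 2 := by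
      funext x
      rw [deriv_centeredTrunc hg.differentiable]
      ring
    rw [h]
    refine hg.2.2.mul_bdd (c := 1) ?_ (.of_forall fun x => ?_)
    · exact (((contDiff_smoothTrunc n).continuous_deriv le_rfl).comp hg.1.continuous |>.pow
        2).aestronglyMeasurable
    · rw [Real.norm_of_nonneg (sq_nonneg _), sq_le_one_iff_abs_le_one]
      exact abs_deriv_smoothTrunc_le n (g x)

/-- The square-integrable functions in `H¹(ν)`. -/
def energySpace (a : ℝ → ℝ) (ν : Measure ℝ) [IsProbabilityMeasure ν] :
    Submodule ℝ (ℝ → ℝ) where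
  carrier := {f | MemH1 a ν f ∧ MemLp f 2 ν}
  zero_mem' := ⟨⟨contDiff_const, by simp, by simp [Pi.zero_def]⟩, MemLp.zero⟩
  add_mem' := by
    rintro f g ⟨hf, hf2⟩ ⟨hg, hg2⟩
    refine ⟨⟨hf.1.add hg.1, ?_, ?_⟩, hf2.add hg2⟩
    · simp only [Pi.add_apply]
      rw [integral_add (hf2.integrable one_le_two) (hg2.integrable one_le_two), hf.2.1, hg.2.1,
        add_zero]
    · refine ((hf.2.2.add hg.2.2).add ((hf.integrable_energy hg).const_mul 2)).congr
        (.of_forall fun x => ?_)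
      simp only [Pi.add_apply, deriv_add (hf.differentiable x) (hg.differentiable x)]
      ring
  smul_mem' := by
    rintro c f ⟨hf, hf2⟩
    refine ⟨⟨hf.1.const_smul c, ?_, ?_⟩, hf2.const_smul c⟩
    · simp only [Pi.smul_apply, integral_smul, hf.2.1, smul_zero]
    · refine (hf.2.2.const_mul (c ^ 2)).congr (.of_forall fun x => ?_)
      simp only [deriv_const_smul c (hf.differentiable x), smul_eq_mul]
      ring

theorem integrable_mul_energySpace (f g : energySpace a ν) :
    Integrable (fun x => f.1 x * g.1 x) ν :=
  f.2.2.integrable_mul g.2.2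

/-- The `L²(ν)` inner product on `energySpace a ν`. -/
noncomputable def l2Form (a : ℝ → ℝ) (ν : Measure ℝ) [IsProbabilityMeasure ν] :
    LinearMap.BilinForm ℝ (energySpace a ν) :=
  LinearMap.mk₂ ℝ (fun f g => ∫ x, f.1 x * g.1 x ∂ν)
    (fun f f' g => by
      rw [← integral_add (integrable_mul_energySpace f g) (integrable_mul_energySpace f' g)]
      simp [add_mul])
    (fun c f g => by simp [mul_assoc, integral_const_mul])
    (fun f g g' => by
      rw [← integral_add (integrable_mul_energySpace f g) (integrable_mul_energySpace f g')]
      simp [mul_add])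
    (fun c f g => by simp [mul_left_comm, integral_const_mul])

/-- The Dirichlet form `∫ Γ(f, g) dν` on `energySpace a ν`. -/
noncomputable def energyForm (a : ℝ → ℝ) (ν : Measure ℝ) [IsProbabilityMeasure ν] :
    LinearMap.BilinForm ℝ (energySpace a ν) :=
  LinearMap.mk₂ ℝ (fun f g => ∫ x, a x * deriv f.1 x * deriv g.1 x ∂ν)
    (fun f f' g => by
      rw [← integral_add (f.2.1.integrable_energy g.2.1) (f'.2.1.integrable_energy g.2.1)]
      congr with x
      simp only [Submodule.coe_add, deriv_add (f.2.1.differentiable x) (f'.2.1.differentiable x)]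
      ring)
    (fun c f g => by
      rw [smul_eq_mul, ← integral_const_mul]
      congr with x
      simp only [Submodule.coe_smul, deriv_const_smul c (f.2.1.differentiable x), smul_eq_mul]
      ring)
    (fun f g g' => by
      rw [← integral_add (f.2.1.integrable_energy g.2.1) (f.2.1.integrable_energy g'.2.1)]
      congr with x
      simp only [Submodule.coe_add, deriv_add (g.2.1.differentiable x) (g'.2.1.differentiable x)]
      ring)
    (fun c f g => by
      rw [smul_eq_mul, ← integral_const_mul]
      congr with x
      simp only [Submodule.coe_smul, deriv_const_smul c (g.2.1.differentiable x), smul_eq_mul]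
      ring)

theorem l2Form_apply (f g : energySpace a ν) : l2Form a ν f g = ∫ x, f.1 x * g.1 x ∂ν := rfl

theorem energyForm_apply (f g : energySpace a ν) :
    energyForm a ν f g = ∫ x, a x * deriv f.1 x * deriv g.1 x ∂ν := rfl

theorem l2Form_self (f : energySpace a ν) : l2Form a ν f f = ∫ x, f.1 x ^ 2 ∂ν := by
  simp only [l2Form_apply, sq]

theorem energyForm_self (f : energySpace a ν) :
    energyForm a ν f f = ∫ x, a x * deriv f.1 x ^ 2 ∂ν := by
  simp only [energyForm_apply, sq, mul_assoc]

theorem l2Form_comm (f g : energySpace a ν) : l2Form a ν f g = l2Form a ν g f := by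
  simp only [l2Form_apply, mul_comm]

theorem energyForm_comm (f g : energySpace a ν) : energyForm a ν f g = energyForm a ν g f := by
  simp only [energyForm_apply, mul_right_comm]

theorem l2Form_self_nonneg (f : energySpace a ν) : 0 ≤ l2Form a ν f f := by
  rw [l2Form_self]
  exact integral_nonneg fun x => sq_nonneg _

theorem energyForm_self_nonneg (ha : ∀ x, 0 ≤ a x) (f : energySpace a ν) :
    0 ≤ energyForm a ν f f := by
  rw [energyForm_self]
  exact integral_nonneg fun x => mul_nonneg (ha x) (sq_nonneg _)

variable {ι : Type*} {p : ι → ℝ → ℝ} {l : ι → ℝ} {lam : ℝ}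

/-- Under the improved Poincaré inequality, weak eigenfunctions are square-integrable. -/
theorem memLp_two_of_weak_eigenfunction (ha : ∀ x, 0 ≤ a x) (hp : ∀ i, MemH1 a ν (p i))
    (hl : ∀ i, 0 < l i) (hlam : 0 < lam)
    (heig : ∀ i, ∀ g, MemH1 a ν g →
      ∫ x, a x * deriv (p i) x * deriv g x ∂ν = l i * ∫ x, p i x * g x ∂ν)
    (hpoinc : ∀ g, MemH1 a ν g → (∀ i, ∫ x, g x * p i x ∂ν = 0) →
      lam * ∫ x, g x ^ 2 ∂ν ≤ ∫ x, a x * deriv g x ^ 2 ∂ν) (i : ι) :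
    MemLp (p i) 2 ν := by
  by_contra hnot
  have hmeas := (hp i).aestronglyMeasurable
  have hzero : ∫ x, a x * deriv (p i) x ^ 2 ∂ν = 0 := by
    have h := heig i (p i) (hp i)
    simp only [mul_assoc, ← sq] at h
    rw [h, integral_undef fun hint => hnot ((memLp_two_iff_integrable_sq hmeas).2 hint), mul_zero]
  have hae : ∀ᵐ x ∂ν, a x * deriv (p i) x = 0 := by
    filter_upwards [(integral_eq_zero_iff_of_nonneg
      (fun x => mul_nonneg (ha x) (sq_nonneg _)) (hp i).2.2).1 hzero] with x hx
    simpa using hx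
  have hae' (n) : ∀ᵐ x ∂ν, a x * deriv (centeredTrunc ν (p i) n) x = 0 := by
    filter_upwards [hae] with x hx
    rw [deriv_centeredTrunc (hp i).differentiable, mul_left_comm, hx, mul_zero]
  refine hnot (memLp_two_of_centeredTrunc_le hmeas (C := 0) fun n => ?_)
  have hu := (hp i).centeredTrunc n
  have horth (j) : ∫ x, centeredTrunc ν (p i) n x * p j x ∂ν = 0 := by
    have h := heig j _ hu
    rw [integral_eq_zero_of_ae] at h
    · simpa [(hl j).ne', mul_comm] using h.symm
    · filter_upwards [hae' n] with x hx
      rw [mul_right_comm, hx, zero_mul, Pi.zero_apply]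
  have h := hpoinc _ hu horth
  rw [integral_eq_zero_of_ae (f := fun x => a x * deriv (centeredTrunc ν (p i) n) x ^ 2)] at h
  · exact nonpos_of_mul_nonpos_right h hlam
  · filter_upwards [hae' n] with x hx
    rw [sq, ← mul_assoc, hx, zero_mul, Pi.zero_apply]

/-- A Poincaré inequality for square-integrable functions forces `H¹(ν) ⊆ L²(ν)`. -/
theorem MemH1.memLp_two_of_poincare (ha : ∀ x, 0 ≤ a x) {C : ℝ} (hC : 0 ≤ C)
    (hpoinc : ∀ u : energySpace a ν, l2Form a ν u u ≤ C * energyForm a ν u u)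
    {g : ℝ → ℝ} (hg : MemH1 a ν g) : MemLp g 2 ν := by
  refine memLp_two_of_centeredTrunc_le hg.aestronglyMeasurable
    (C := C * ∫ x, a x * deriv g x ^ 2 ∂ν) fun n => ?_
  have hu := hg.centeredTrunc n
  have h := hpoinc ⟨_, hu, memLp_centeredTrunc hg.aestronglyMeasurable n 2⟩
  rw [l2Form_self, energyForm_self] at h
  exact h.trans (mul_le_mul_of_nonneg_left (integral_mono hu.2.2 hg.2.2 fun x =>
    mul_le_mul_of_nonneg_left (sq_deriv_centeredTrunc_le hg.differentiable n x) (ha x)) hC)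

end EnergySpace

/-- Approximate integration by parts formula (Theorem 3.1). -/
theorem approx_ibp
    (ν : Measure ℝ) [IsProbabilityMeasure ν]
    (a : ℝ → ℝ) (ha : ∀ x, 0 ≤ a x)
    (k : ℕ) (hk : 1 ≤ k)
    (f : ℝ → ℝ) (hf : MemH1 a ν f)
    (Λ : ℝ) (hf2 : ∫ x, (f x) ^ 2 ∂ν = 1)
    (hfΓ : ∫ x, a x * (deriv f x) ^ 2 ∂ν ≤ Λ)
    (p : Fin (k - 1) → ℝ → ℝ) (hp : ∀ i, MemH1 a ν (p i))
    (lams : Fin (k - 1) → ℝ) (hlams : ∀ i, 0 < lams i)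
    (lam : ℝ) (hlam : 0 < lam)
    (horth : ∀ i j, i ≠ j → ∫ x, p i x * p j x ∂ν = 0)
    (heig : ∀ i, ∀ g, MemH1 a ν g →
      ∫ x, a x * deriv (p i) x * deriv g x ∂ν = lams i * ∫ x, p i x * g x ∂ν)
    (hperp : ∀ i, ∫ x, (f x - ∑ j, p j x) * p i x ∂ν = 0)
    (hpoinc : ∀ g, MemH1 a ν g → (∀ i, ∫ x, g x * p i x ∂ν = 0) →
      lam * ∫ x, (g x) ^ 2 ∂ν ≤ ∫ x, a x * (deriv g x) ^ 2 ∂ν) :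
    ∀ g, MemH1 a ν g → (∀ i, ∫ x, g x * p i x ∂ν = 0) →
      |∫ x, (lam * (f x - ∑ i, p i x) * g x
          - a x * deriv (fun y => f y - ∑ i, p i y) x * deriv g x) ∂ν|
        ≤ Real.sqrt (Λ - lam + ∑ i, (lam - lams i) * ∫ x, (p i x) ^ 2 ∂ν)
          * Real.sqrt (∫ x, a x * (deriv g x) ^ 2 ∂ν) := by
  intro g hg hgp
  have hpL := memLp_two_of_weak_eigenfunction ha hp hlams hlam heig hpoinc
  let P : Fin (k - 1) → energySpace a ν := fun i => ⟨p i, hp i, hpL i⟩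
  have heigP (i) (u : energySpace a ν) : energyForm a ν (P i) u = lams i * l2Form a ν (P i) u :=
    heig i u.1 u.2.1
  have hpoincP (u : energySpace a ν) (hu : ∀ i, l2Form a ν u (P i) = 0) :
      lam * l2Form a ν u u ≤ energyForm a ν u u := by
    rw [l2Form_self, energyForm_self]
    exact hpoinc u.1 u.2.1 hu
  obtain ⟨C, hC, hCle⟩ := exists_poincare_of_eigenvectors l2Form_comm energyForm_comm
    (energyForm_self_nonneg ha) hlams hlam horth heigP hpoincP
  let F : energySpace a ν := ⟨f, hf, hf.memLp_two_of_poincare ha hC hCle⟩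
  let G : energySpace a ν := ⟨g, hg, hg.memLp_two_of_poincare ha hC hCle⟩
  obtain ⟨Q, hQ⟩ : ∃ Q, Q = F - ∑ i, P i := ⟨_, rfl⟩
  have hQval : Q.1 = fun x => f x - ∑ i, p i x := by
    funext x
    simp [hQ, F, P]
  have hQp (i) : l2Form a ν Q (P i) = 0 := by
    rw [l2Form_apply, hQval]
    exact hperp i
  have hmain := abs_sub_le_of_eigenvectors l2Form_comm energyForm_comm l2Form_self_nonneg hlam.le
    horth heigP hpoincP hQ hQp (g := G) hgp
  have hint : ∫ x, (lam * (f x - ∑ i, p i x) * g x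
      - a x * deriv (fun y => f y - ∑ i, p i y) x * deriv g x) ∂ν =
      lam * l2Form a ν Q G - energyForm a ν Q G := by
    rw [l2Form_apply, energyForm_apply, ← integral_const_mul,
      ← integral_sub ((integrable_mul_energySpace Q G).const_mul lam)
        (Q.2.1.integrable_energy G.2.1), hQval]
    simp only [mul_assoc, G]
  have hFF : energyForm a ν F F ≤ Λ := by rwa [energyForm_self]
  have hF1 : l2Form a ν F F = 1 := by rwa [l2Form_self]
  simp only [l2Form_self (P _), energyForm_self G, hF1, mul_one] at hmain
  rw [hint]
  refine hmain.trans (mul_le_mul_of_nonneg_right (Real.sqrt_le_sqrt ?_) (Real.sqrt_nonneg _))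
  simp only [P]
  linarith
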